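/- Let d ≥ 2 and set α = 2/(d(d−1)). There do not exist a group homomorphism ρ from N_d into the group of C^{1+α} diffeomorphisms of [0,1] and a family {J_v : v ∈ ℤ^d} of pairwise disjoint nondegenerate subintervals of [0,1] disposed respecting the lexicographic order such that ρ(f)(J_v) = J_{f·v} for every f ∈ N_d and every v ∈ ℤ^d. (Equivalently, the Farb–Franks action of N_d on [0,1] is not topologically semiconjugated to an action by C^{1+α} diffeomorphisms.) -/

import Mathlib

/-- `M` is a lower-triangular matrix with all diagonal entries equal to `1`
(i.e. an element of the group `N_d` when the matrices are `(d+1) × (d+1)`). -/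
def IsUnitLowerTriangular {n : ℕ} (M : Matrix (Fin n) (Fin n) ℤ) : Prop :=
  (∀ i j : Fin n, i < j → M i j = 0) ∧ (∀ i : Fin n, M i i = 1)

/-- The action of `N_d` on `ℤ^d`: `M · v = w` where `(1, w)` is the column vector
`M (1, v)`. -/
def ndAct {d : ℕ} (M : Matrix (Fin (d + 1)) (Fin (d + 1)) ℤ) (v : Fin d → ℤ) :
    Fin d → ℤ :=
  fun i => M.mulVec (Fin.cons 1 v) i.succ

section
open Finset

/-- Step coefficients: `1` plus a Beatty increment. -/
def ffc (N q s : ℕ) : ℕ := 1 + ((s + 1) * q / N - s * q / N)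

/-- The polynomial path. -/
def ffu (c : ℕ → ℕ → ℕ → ℕ) : ℕ → ℕ → ℕ
  | 0, _ => 1
  | s + 1, i => ffu c s i + ∑ j ∈ range i, c i j s * ffu c s j

lemma ffc_pos (N q s : ℕ) : 1 ≤ ffc N q s := by unfold ffc; omega

lemma ffc_le (N q s : ℕ) (hq : q < N) : ffc N q s ≤ 2 := by
  unfold ffc
  have hN : 0 < N := by omega
  have : (s + 1) * q / N ≤ s * q / N + 1 := by
    rw [← Nat.add_div_right _ hN]
    apply Nat.div_le_div_right
    rw [add_mul]; omega
  omega

lemma ffu_upper (c : ℕ → ℕ → ℕ → ℕ) (hc : ∀ i j s, c i j s ≤ 2) (s i : ℕ) :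
    ffu c s i ≤ (3 * (s + 1)) ^ i := by
  induction s generalizing i with
  | zero => simp only [ffu]; exact Nat.one_le_pow _ _ (by norm_num)
  | succ s ih =>
    have h1 : ∀ x i : ℕ, x ^ i + 2 * ∑ j ∈ range i, x ^ j ≤ (x + 3) ^ i := by
      intro x i
      induction i with
      | zero => simp
      | succ i ih =>
        rw [sum_range_succ, pow_succ (x + 3)]
        have := Nat.mul_le_mul_right (x + 3) ih
        refine le_trans ?_ this
        generalize ∑ j ∈ range i, x ^ j = S
        rw [pow_succ]
        nlinarith [Nat.zero_le (x * S), Nat.zero_le (x ^ i)]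
    simp only [ffu]
    calc _ ≤ (3 * (s + 1)) ^ i + ∑ j ∈ range i, 2 * (3 * (s + 1)) ^ j := by
          apply Nat.add_le_add (ih i)
          exact sum_le_sum fun j _ => Nat.mul_le_mul (hc _ _ _) (ih j)
      _ ≤ (3 * (s + 1) + 3) ^ i := by rw [← mul_sum]; exact h1 _ _
      _ = _ := by ring_nf

lemma ffu_mono (c : ℕ → ℕ → ℕ → ℕ) (i : ℕ) : Monotone fun s => ffu c s i :=
  monotone_nat_of_le_succ fun s => by simp only [ffu]; omega

lemma ffu_lower (c : ℕ → ℕ → ℕ → ℕ) (hc : ∀ i j s, 1 ≤ c i j s) (s i : ℕ) :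
    (s + i).choose i ≤ ffu c s i := by
  induction s generalizing i with
  | zero => simp [ffu]
  | succ s ih =>
    have h1 : ∀ i, (s + i).choose i + ∑ j ∈ range i, (s + j).choose j = (s + 1 + i).choose i := by
      intro i
      induction i with
      | zero => simp
      | succ i ih =>
        rw [sum_range_succ, add_comm (∑ j ∈ range i, _), ih]
        have : s + 1 + (i + 1) = (s + 1 + i) + 1 := by ring
        rw [this, Nat.choose_succ_succ, add_comm]
        congr 2; omega
    rw [← h1]
    simp only [ffu]
    apply Nat.add_le_add (ih i)
    refine sum_le_sum fun j _ => ?_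
    calc _ ≤ ffu c s j := ih j
      _ = 1 * ffu c s j := (one_mul _).symm
      _ ≤ _ := Nat.mul_le_mul_right _ (hc _ _ _)

lemma ffu_lower' (c : ℕ → ℕ → ℕ → ℕ) (hc : ∀ i j s, 1 ≤ c i j s) (s i : ℕ) :
    (s + 1) ^ i ≤ i.factorial * ffu c s i := by
  calc (s + 1) ^ i ≤ (s + 1).ascFactorial i := Nat.pow_succ_le_ascFactorial _ _
    _ = i.factorial * (s + i).choose i := by
        rw [Nat.ascFactorial_eq_factorial_mul_choose]
    _ ≤ _ := Nat.mul_le_mul_left _ (ffu_lower c hc s i)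

lemma ffu_sum_lower (c : ℕ → ℕ → ℕ → ℕ) (hc : ∀ i j s, 1 ≤ c i j s) (n j : ℕ) :
    n ^ (j + 1) ≤ (j + 1).factorial * ∑ k ∈ range n, ffu c k j := by
  induction n with
  | zero => simp
  | succ n ih =>
    rw [sum_range_succ, mul_add]
    have h2 : (n + 1) ^ (j + 1) ≤ n ^ (j + 1) + (j + 1) * (n + 1) ^ j := by
      clear ih
      induction j with
      | zero => simp
      | succ j ih =>
        rw [pow_succ, pow_succ n]
        have h3 : n ^ (j + 1) ≤ (n + 1) ^ (j + 1) := Nat.pow_le_pow_left (by omega) _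
        have h4 : (n + 1) ^ (j + 1) = (n + 1) * (n + 1) ^ j := by ring
        nlinarith
    have h3 := ffu_lower' c hc n j
    rw [Nat.factorial_succ, mul_assoc (j + 1) _ (ffu c n j)] at *
    have := Nat.mul_le_mul_left (j + 1) h3
    omega

lemma ffu_eq_sum (c : ℕ → ℕ → ℕ → ℕ) (n i : ℕ) :
    ffu c n i = 1 + ∑ j ∈ range i, ∑ k ∈ range n, c i j k * ffu c k j := by
  induction n with
  | zero => simp [ffu]
  | succ n ih => 
    simp only [ffu, sum_range_succ, sum_add_distrib]
    omega

lemma abel_bound (r u : ℕ → ℝ) (hr : ∀ k, |r k| ≤ 1) (hu : Monotone u) (hu0 : 0 ≤ u 0) (n : ℕ) :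
    |∑ k ∈ range n, (r (k + 1) - r k) * u k| ≤ 2 * u n := by
  have h : |∑ k ∈ range n, (r (k + 1) - r k) * u k - r n * u n| ≤ u n := by
    induction n with
    | zero => 
      simp [abs_mul, abs_of_nonneg hu0]
      nlinarith [hr 0]
    | succ n ih =>
      rw [sum_range_succ]
      have h1 := hu (Nat.le_succ n)
      have h2 : |r (n + 1) * (u n - u (n + 1))| ≤ u (n + 1) - u n := by
        rw [abs_mul, abs_sub_comm, abs_of_nonneg (sub_nonneg.2 h1)]
        nlinarith [hr (n + 1), sub_nonneg.2 h1]
      calc _ = |(∑ k ∈ range n, (r (k + 1) - r k) * u k - r n * u n) 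
              + r (n + 1) * (u n - u (n + 1))| := by congr 1; ring
        _ ≤ _ := abs_add_le _ _
        _ ≤ _ := by linarith
  have hn : 0 ≤ u n := hu0.trans (hu (Nat.zero_le _))
  have h2 : |r n * u n| ≤ u n := by
    rw [abs_mul, abs_of_nonneg hn]; nlinarith [hr n]
  rw [abs_le] at *
  constructor <;> linarith

lemma ffc_cast (N q s : ℕ) (hq : q < N) : 
    (ffc N q s : ℝ) = 1 + q / N - (Int.fract (((s + 1 : ℕ) : ℝ) * q / N) - Int.fract ((s : ℝ) * q / N)) := by
  unfold ffc
  have hN : 0 < N := by omega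
  have hle : s * q / N ≤ (s + 1) * q / N := Nat.div_le_div_right (Nat.mul_le_mul_right _ (by omega))
  rw [Nat.cast_add, Nat.cast_sub hle]
  have h : ∀ s : ℕ, ((s * q / N : ℕ) : ℝ) = (s : ℝ) * q / N - Int.fract ((s : ℝ) * q / N) := by
    intro s
    rw [← Int.floor_add_fract ((s : ℝ) * q / N)]
    have : ((s : ℝ) * q / N) = ((s * q : ℕ) : ℝ) / (N : ℝ) := by push_cast; rfl
    simp only [Int.floor_add_fract]
    rw [Int.self_sub_fract, this]
    have h2 := Nat.floor_div_eq_div (K := ℝ) (s * q) N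
    rw [← h2, ← natCast_floor_eq_intCast_floor (by positivity)]
  rw [h, h]
  push_cast
  ring

lemma step_diff (N q q' : ℕ) (hq : q < N) (hq' : q' < N) (u : ℕ → ℕ) (hu : Monotone u) (n : ℕ) :
    |(q : ℝ) - q'| / N * ∑ k ∈ range n, (u k : ℝ) ≤ 
      |(∑ k ∈ range n, (ffc N q k : ℝ) * u k) - ∑ k ∈ range n, (ffc N q' k : ℝ) * u k| + 2 * u n := by
  set r : ℕ → ℝ := fun s => Int.fract ((s : ℝ) * q / N) - Int.fract ((s : ℝ) * q' / N)
  have hr : ∀ k, |r k| ≤ 1 := by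
    intro k
    have h1 := Int.fract_nonneg ((k : ℝ) * q / N)
    have h2 := Int.fract_lt_one ((k : ℝ) * q / N)
    have h3 := Int.fract_nonneg ((k : ℝ) * q' / N)
    have h4 := Int.fract_lt_one ((k : ℝ) * q' / N)
    simp only [r]
    rw [abs_le]; constructor <;> linarith
  have hab := abel_bound r (fun k => (u k : ℝ)) hr (fun a b h => Nat.cast_le.2 (hu h)) (by positivity) n
  have e : (∑ k ∈ range n, (ffc N q k : ℝ) * u k) - ∑ k ∈ range n, (ffc N q' k : ℝ) * u k
     = ((q : ℝ) - q') / N * ∑ k ∈ range n, (u k : ℝ) - ∑ k ∈ range n, (r (k + 1) - r k) * u k := by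
    rw [mul_sum, ← sum_sub_distrib, ← sum_sub_distrib]
    refine sum_congr rfl fun k _ => ?_
    rw [ffc_cast _ _ _ hq, ffc_cast _ _ _ hq']
    simp only [r]
    ring
  rw [e]
  have hS : 0 ≤ ∑ k ∈ range n, (u k : ℝ) := by positivity
  have : |(q : ℝ) - q'| / N * ∑ k ∈ range n, (u k : ℝ) = |((q : ℝ) - q') / N * ∑ k ∈ range n, (u k : ℝ)| := by
    rw [abs_mul, abs_div, abs_of_nonneg hS, Nat.abs_cast]
  rw [this]
  have := abs_sub_abs_le_abs_sub (((q : ℝ) - q') / N * ∑ k ∈ range n, (u k : ℝ)) (∑ k ∈ range n, (r (k + 1) - r k) * u k)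
  linarith

/-- Two parameter arrays in the same fibre at time `n`: the first difference is small. -/
lemma fiber_diff (N d n : ℕ) (hn : 1 ≤ n) (q q' : ℕ → ℕ → ℕ)
    (hq : ∀ i j, q i j < N) (hq' : ∀ i j, q' i j < N)
    (i j : ℕ) (hi : i < d) (hj : j < i)
    (hlt : ∀ i' < i, ∀ j' < i', q i' j' = q' i' j')
    (hgt : ∀ j', j < j' → j' < i → q i j' = q' i j')
    (heq : ffu (fun i j s => ffc N (q i j) s) n i = ffu (fun i j s => ffc N (q' i j) s) n i) :
    |(q i j : ℝ) - q' i j| ≤ (3 * 6 ^ d * d.factorial : ℕ) * N / n := by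
  set c := fun i j s => ffc N (q i j) s with hc
  set c' := fun i j s => ffc N (q' i j) s with hc'
  have hN : 0 < N := by have := hq 0 0; omega
  have hagree : ∀ s, ∀ i' < i, ffu c s i' = ffu c' s i' := by
    intro s
    induction s with
    | zero => intros; simp [ffu]
    | succ s ih =>
      intro i' hi'
      simp only [ffu]
      rw [ih i' hi']
      congr 1
      refine sum_congr rfl fun j' hj' => ?_
      rw [mem_range] at hj'
      rw [ih j' (by omega)]
      simp only [hc, hc']
      rw [hlt i' hi' j' hj']
  have hup : ∀ s j, ffu c s j ≤ (3 * (s + 1)) ^ j := 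
    ffu_upper c (fun i j s => ffc_le _ _ _ (hq i j))
  have hlow := ffu_sum_lower c (fun i j s => ffc_pos _ _ _) n j
  set S : ℕ → ℝ := fun j' => ∑ k ∈ range n, (ffc N (q i j') k : ℝ) * ffu c k j' with hS
  set S' : ℕ → ℝ := fun j' => ∑ k ∈ range n, (ffc N (q' i j') k : ℝ) * ffu c k j' with hS'
  have hsum : ∑ j' ∈ range i, (S j' - S' j') = 0 := by
    rw [ffu_eq_sum, ffu_eq_sum] at heq
    have h1 : ∑ j' ∈ range i, S j' = ∑ j' ∈ range i, S' j' := by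
      have : (∑ j ∈ range i, ∑ k ∈ range n, c i j k * ffu c k j) = 
        ∑ j ∈ range i, ∑ k ∈ range n, c' i j k * ffu c k j := by
        have : (∑ j ∈ range i, ∑ k ∈ range n, c' i j k * ffu c k j) = 
          ∑ j ∈ range i, ∑ k ∈ range n, c' i j k * ffu c' k j := by
          refine sum_congr rfl fun j hj => sum_congr rfl fun k _ => ?_
          rw [hagree k j (mem_range.1 hj)]
        omega
      have := congrArg (Nat.cast (R := ℝ)) this
      push_cast at this
      exact this
    rw [sum_sub_distrib, h1, sub_self]
  have hsmall : ∀ j', |S j' - S' j'| ≤ (n : ℝ) * (6 * n : ℝ) ^ j' := by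
    intro j'
    simp only [hS, hS']
    rw [← sum_sub_distrib]
    calc _ ≤ ∑ k ∈ range n, |(ffc N (q i j') k : ℝ) * ffu c k j' - (ffc N (q' i j') k : ℝ) * ffu c k j'| :=
          abs_sum_le_sum_abs _ _
      _ ≤ ∑ k ∈ range n, (6 * n : ℝ) ^ j' := by
          refine sum_le_sum fun k hk => ?_
          rw [mem_range] at hk
          rw [← sub_mul, abs_mul, Nat.abs_cast]
          have h1 : |(ffc N (q i j') k : ℝ) - ffc N (q' i j') k| ≤ 1 := by
            have a1 : (1 : ℝ) ≤ ffc N (q i j') k := by exact_mod_cast ffc_pos _ _ _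
            have a2 : (1 : ℝ) ≤ ffc N (q' i j') k := by exact_mod_cast ffc_pos _ _ _
            have a3 : (ffc N (q i j') k : ℝ) ≤ 2 := by exact_mod_cast ffc_le _ _ _ (hq _ _)
            have a4 : (ffc N (q' i j') k : ℝ) ≤ 2 := by exact_mod_cast ffc_le _ _ _ (hq' _ _)
            rw [abs_le]; constructor <;> linarith
          have h2 : (ffu c k j' : ℝ) ≤ (6 * n : ℝ) ^ j' := by
            have : ffu c k j' ≤ (6 * n) ^ j' := (hup k j').trans (Nat.pow_le_pow_left (by omega) _)
            exact_mod_cast this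
          nlinarith [Nat.cast_nonneg (α := ℝ) (ffu c k j'), abs_nonneg ((ffc N (q i j') k : ℝ) - ffc N (q' i j') k)]
      _ = _ := by simp
  have hSj : |S j - S' j| ≤ (6 * n : ℝ) ^ j := by
    have h1 : ∑ j' ∈ range (j + 1), (S j' - S' j') = 0 := by
      rw [← hsum]
      apply sum_subset
      · intro x hx; rw [mem_range] at *; omega
      · intro x hx hx2
        rw [mem_range] at *
        simp only [hS, hS']
        rw [hgt x (by omega) hx, sub_self]
    rw [sum_range_succ] at h1
    have h2 : S j - S' j = - ∑ j' ∈ range j, (S j' - S' j') := by linarith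
    rw [h2, abs_neg]
    have hn1 : (1 : ℝ) ≤ n := by exact_mod_cast hn
    have h3 : ∀ j : ℕ, ∑ j' ∈ range j, (n : ℝ) * (6 * n : ℝ) ^ j' ≤ (6 * n : ℝ) ^ j := by
      intro j
      induction j with
      | zero => simp
      | succ j ih =>
        rw [sum_range_succ, pow_succ]
        have : (0 : ℝ) < (6 * n : ℝ) ^ j := by positivity
        nlinarith
    calc _ ≤ ∑ j' ∈ range j, |S j' - S' j'| := abs_sum_le_sum_abs _ _
      _ ≤ _ := (sum_le_sum fun j' _ => hsmall j').trans (h3 j)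
  have hstep := step_diff N (q i j) (q' i j) (hq _ _) (hq' _ _) (fun k => ffu c k j) (ffu_mono c j) n
  have hun : (ffu c n j : ℝ) ≤ (6 * n : ℝ) ^ j := by
    have : ffu c n j ≤ (6 * n) ^ j := (hup n j).trans (Nat.pow_le_pow_left (by omega) _)
    exact_mod_cast this
  have hstep2 : |(q i j : ℝ) - q' i j| / N * ∑ k ∈ range n, (ffu c k j : ℝ) ≤ 3 * (6 * n : ℝ) ^ j := by
    refine hstep.trans ?_
    change |S j - S' j| + _ ≤ _
    linarith
  have hlow2 : (n : ℝ) ^ (j + 1) ≤ (j + 1).factorial * ∑ k ∈ range n, (ffu c k j : ℝ) := by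
    exact_mod_cast hlow
  have hnpos : (0 : ℝ) < n := by exact_mod_cast hn
  have hNpos : (0 : ℝ) < N := by exact_mod_cast hN
  have hfac : ((j + 1).factorial : ℝ) ≤ d.factorial := by
    exact_mod_cast Nat.factorial_le (by omega)
  have h6 : (6 : ℝ) ^ j ≤ 6 ^ d := pow_le_pow_right₀ (by norm_num) (by omega)
  set D := |(q i j : ℝ) - q' i j|
  have hD : 0 ≤ D := abs_nonneg _
  have key : D / N * n ^ (j + 1) ≤ 3 * 6 ^ d * d.factorial * n ^ j := by
    calc _ ≤ D / N * ((j + 1).factorial * ∑ k ∈ range n, (ffu c k j : ℝ)) := by gcongr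
      _ = (j + 1).factorial * (D / N * ∑ k ∈ range n, (ffu c k j : ℝ)) := by ring
      _ ≤ d.factorial * (3 * (6 * n : ℝ) ^ j) := by gcongr
      _ = d.factorial * (3 * (6 ^ j * n ^ j)) := by rw [mul_pow]
      _ ≤ d.factorial * (3 * (6 ^ d * n ^ j)) := by gcongr
      _ = _ := by ring
  have key2 : D / N * n ≤ 3 * 6 ^ d * d.factorial := by
    rw [pow_succ'] at key
    rw [← mul_assoc] at key
    exact le_of_mul_le_mul_right key (by positivity)
  push_cast
  rw [le_div_iff₀ hnpos]
  calc D * n = (D / N * n) * N := by field_simp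
    _ ≤ _ := by gcongr

/-- Index set of the parameters. -/
abbrev FFIdx (d : ℕ) := Σ i : Fin d, Fin i

def ffext {d N : ℕ} (q : FFIdx d → Fin N) (i j : ℕ) : ℕ :=
  if h : i < d ∧ j < i then q ⟨⟨i, h.1⟩, ⟨j, h.2⟩⟩ else 0

def ffcoef {d N : ℕ} (q : FFIdx d → Fin N) : ℕ → ℕ → ℕ → ℕ := fun i j s => ffc N (ffext q i j) s

def ffstate {d N : ℕ} (q : FFIdx d → Fin N) (n : ℕ) : Fin d → ℕ := fun i => ffu (ffcoef q) n i

lemma card_FFIdx (d : ℕ) : Fintype.card (FFIdx d) = ∑ i ∈ range d, i := by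
  simp [FFIdx, Fin.sum_univ_eq_sum_range (fun i => i)]

lemma ffext_lt {d N : ℕ} (hN : 0 < N) (q : FFIdx d → Fin N) (i j : ℕ) : ffext q i j < N := by
  unfold ffext; split_ifs with h
  · exact (q _).2
  · exact hN

lemma ff_fiber_card (d N n : ℕ) (hn : 1 ≤ n) (hN : 0 < N) (w : Fin d → ℕ) :
    (#{q : FFIdx d → Fin N | ffstate q n = w} : ℕ) ≤ 
      (⌊((3 * 6 ^ d * d.factorial : ℕ) * N / n : ℝ)⌋₊ + 1) ^ (Fintype.card (FFIdx d)) := by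
  set K := ⌊((3 * 6 ^ d * d.factorial : ℕ) * N / n : ℝ)⌋₊ with hK
  have hcard : Fintype.card (FFIdx d → Fin (K + 1)) = (K + 1) ^ (Fintype.card (FFIdx d)) := by simp
  rw [← hcard, ← Finset.card_univ]
  apply Finset.card_le_card_of_injOn 
    (fun q t => (⟨(q t : ℕ) % (K + 1), Nat.mod_lt _ (Nat.succ_pos _)⟩ : Fin (K + 1))) (by simp)
  intro q hq q' hq' he
  simp only [coe_filter, mem_univ, true_and, Set.mem_ofPred_eq] at hq hq'
  have hmod : ∀ t, (q t : ℕ) % (K + 1) = (q' t : ℕ) % (K + 1) := fun t => by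
    have := congrFun he t
    simpa using this
  have hmod2 : ∀ i j, ffext q i j % (K + 1) = ffext q' i j % (K + 1) := by
    intro i j; unfold ffext; split_ifs with h
    · exact hmod _
    · rfl
  have main : ∀ i < d, ∀ j < i, ffext q i j = ffext q' i j := by
    intro i
    induction i using Nat.strong_induction_on with
    | _ i IH =>
      intro hi
      by_contra hcon
      push Not at hcon
      obtain ⟨j0, hj0, hne0⟩ := hcon
      have hex : ∃ j, (j < i ∧ ffext q i j ≠ ffext q' i j) ∧ 
          ∀ j', j < j' → j' < i → ffext q i j' = ffext q' i j' := by
        classical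
        set A := (range i).filter fun j => ffext q i j ≠ ffext q' i j
        have hA : A.Nonempty := ⟨j0, by simp [A, hj0, hne0]⟩
        refine ⟨A.max' hA, ?_, ?_⟩
        · have := A.max'_mem hA
          simpa [A] using this
        · intro j' h1 h2
          by_contra h3
          have : j' ∈ A := by simp [A, h2, h3]
          exact absurd (A.le_max' _ this) (by omega)
      obtain ⟨j, ⟨hj, hne⟩, hgt⟩ := hex
      have heq : ffu (ffcoef q) n i = ffu (ffcoef q') n i := by
        have := congrFun (hq.trans hq'.symm) ⟨i, hi⟩
        exact this
      have hb := fiber_diff N d n hn (ffext q) (ffext q') (ffext_lt hN q) (ffext_lt hN q') i j hi hj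
        (fun i' hi' => IH i' hi' (by omega)) hgt heq
      apply hne
      have hlt : |((ffext q i j : ℤ)) - ffext q' i j| < (K + 1 : ℕ) := by
        have h1 : |(ffext q i j : ℝ) - ffext q' i j| < (K : ℝ) + 1 := 
          lt_of_le_of_lt hb (Nat.lt_floor_add_one _)
        have h2 : ((|((ffext q i j : ℤ)) - ffext q' i j| : ℤ) : ℝ) < ((K + 1 : ℕ) : ℤ) := by
          push_cast; exact h1
        exact_mod_cast h2
      have hdvd : ((K + 1 : ℕ) : ℤ) ∣ (ffext q i j : ℤ) - ffext q' i j := by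
        have : (ffext q' i j) ≡ (ffext q i j) [MOD (K + 1)] := (hmod2 i j).symm
        exact (Nat.modEq_iff_dvd).1 this
      have := Int.eq_zero_of_abs_lt_dvd hdvd hlt
      omega
  funext ⟨i, j⟩
  have := main i i.2 j j.2
  unfold ffext at this
  rw [dif_pos ⟨i.2, j.2⟩, dif_pos ⟨i.2, j.2⟩] at this
  exact Fin.ext this

lemma jensen_pow {β : Type*} [Fintype β] [Nonempty β] (f : β → ℝ) (hf : ∀ x, 0 ≤ f x) (a : ℝ)
    (ha0 : 0 ≤ a) (ha1 : a ≤ 1) :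
    ∑ x, f x ^ a ≤ Fintype.card β * ((∑ x, f x) / Fintype.card β) ^ a := by
  have hc : (0 : ℝ) < Fintype.card β := by exact_mod_cast Fintype.card_pos
  have := (Real.concaveOn_rpow ha0 ha1).le_map_sum (t := (univ : Finset β)) 
    (w := fun _ => 1 / (Fintype.card β : ℝ)) (p := f) (fun _ _ => by positivity) 
    (by simp [hc.ne']) (fun x _ => hf x)
  simp only [smul_eq_mul, ← mul_sum] at this
  rw [one_div, inv_mul_le_iff₀ hc] at this
  rwa [div_eq_inv_mul]

/-- Averaged estimate at time `n`. -/
lemma ff_avg (d N n : ℕ) (hd : 2 ≤ d) (hn : 1 ≤ n) (hnN : n ≤ N) (ell : (Fin d → ℕ) → ℝ) (hl : ∀ w, 0 ≤ ell w)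
    (T : ℝ) (hT : ∑ w ∈ univ.image (fun q : FFIdx d → Fin N => ffstate q n), ell w ≤ T) (a : ℝ)
    (ha : a * Fintype.card (FFIdx d) = 1) (ha1 : a ≤ 1) :
    ∑ q : FFIdx d → Fin N, ell (ffstate q n) ^ a ≤ 
      (N : ℝ) ^ (Fintype.card (FFIdx d)) * (((3 * 6 ^ d * d.factorial + 1 : ℕ) : ℝ) * T ^ a / n) := by
  set D := Fintype.card (FFIdx d) with hD
  set Cst := 3 * 6 ^ d * d.factorial with hCst
  have hN : 0 < N := by omega
  have hDpos : 0 < D := by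
    rcases Nat.eq_zero_or_pos D with h | h
    · rw [h] at ha; simp at ha
    · exact h
  have hDr : (0 : ℝ) < D := by exact_mod_cast hDpos
  have ha0 : 0 < a := by
    by_contra h
    push Not at h
    nlinarith
  have : Nonempty (Fin N) := ⟨⟨0, hN⟩⟩
  have hcard : (Fintype.card (FFIdx d → Fin N) : ℝ) = (N : ℝ) ^ D := by simp [hD]
  have hj := jensen_pow (fun q : FFIdx d → Fin N => ell (ffstate q n)) (fun q => hl _) a ha0.le ha1
  rw [hcard] at hj
  refine hj.trans ?_
  have hNr : (0 : ℝ) < N := by exact_mod_cast hN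
  have hnr : (0 : ℝ) < n := by exact_mod_cast hn
  have hT0 : 0 ≤ T := (sum_nonneg fun _ _ => hl _).trans hT
  have hKle : ((⌊(Cst * N / n : ℝ)⌋₊ + 1 : ℕ) : ℝ) ≤ (Cst + 1 : ℕ) * N / n := by
    push_cast
    have h1 : (⌊(Cst * N / n : ℝ)⌋₊ : ℝ) ≤ Cst * N / n := Nat.floor_le (by positivity)
    have h2 : (1 : ℝ) ≤ N / n := by rw [le_div_iff₀ hnr]; simpa using hnN
    have h3 : ((Cst : ℝ) + 1) * N / n = Cst * N / n + N / n := by ring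
    rw [h3]; linarith
  have hsum : ∑ q : FFIdx d → Fin N, ell (ffstate q n) ≤ ((Cst + 1 : ℕ) * N / n : ℝ) ^ D * T := by
    rw [Finset.sum_comp ell (fun q : FFIdx d → Fin N => ffstate q n)]
    calc _ ≤ ∑ w ∈ univ.image (fun q : FFIdx d → Fin N => ffstate q n), ((Cst + 1 : ℕ) * N / n : ℝ) ^ D * ell w := by
          refine sum_le_sum fun w _ => ?_
          rw [nsmul_eq_mul]
          apply mul_le_mul_of_nonneg_right _ (hl w)
          have := ff_fiber_card d N n hn hN w
          calc _ ≤ (((⌊(Cst * N / n : ℝ)⌋₊ + 1) ^ D : ℕ) : ℝ) := by exact_mod_cast this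
            _ = ((⌊(Cst * N / n : ℝ)⌋₊ + 1 : ℕ) : ℝ) ^ D := by push_cast; rfl
            _ ≤ _ := by gcongr
      _ = _ := by rw [← mul_sum]
      _ ≤ _ := by gcongr
  apply mul_le_mul_of_nonneg_left _ (by positivity)
  calc _ ≤ (((Cst + 1 : ℕ) * N / n : ℝ) ^ D * T / N ^ D) ^ a := by
        apply Real.rpow_le_rpow _ _ ha0.le
        · exact div_nonneg (sum_nonneg fun _ _ => hl _) (by positivity)
        · gcongr
    _ = (((Cst + 1 : ℕ) / n : ℝ) ^ D * T) ^ a := by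
        congr 1
        rw [div_pow, div_pow, mul_pow]
        field_simp
    _ = ((Cst + 1 : ℕ) / n : ℝ) * T ^ a := by
        rw [Real.mul_rpow (by positivity) hT0, ← Real.rpow_natCast, ← Real.rpow_mul (by positivity),
          mul_comm (D : ℝ) a, ha, Real.rpow_one]
    _ = _ := by ring

/-- There is a good path. -/
lemma ff_exists_path (d N : ℕ) (hd : 2 ≤ d) (hN : 0 < N) (ell : (Fin d → ℕ) → ℝ) (hl : ∀ w, 0 ≤ ell w)
    (T : ℕ → ℝ) (hT : ∀ n, 1 ≤ n → n ≤ N → 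
      ∑ w ∈ univ.image (fun q : FFIdx d → Fin N => ffstate q n), ell w ≤ T n) (a : ℝ)
    (ha : a * Fintype.card (FFIdx d) = 1) (ha1 : a ≤ 1) :
    ∃ q : FFIdx d → Fin N, ∑ n ∈ Icc 1 N, ell (ffstate q n) ^ a ≤
      ∑ n ∈ Icc 1 N, ((3 * 6 ^ d * d.factorial + 1 : ℕ) : ℝ) * T n ^ a / n := by
  have : Nonempty (Fin N) := ⟨⟨0, hN⟩⟩
  have h := Finset.exists_le_of_sum_le (s := (univ : Finset (FFIdx d → Fin N))) 
    (f := fun q => ∑ n ∈ Icc 1 N, ell (ffstate q n) ^ a) 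
    (g := fun _ => ∑ n ∈ Icc 1 N, ((3 * 6 ^ d * d.factorial + 1 : ℕ) : ℝ) * T n ^ a / n)
    univ_nonempty ?_
  · obtain ⟨q, _, hq⟩ := h
    exact ⟨q, hq⟩
  · rw [sum_comm, sum_const, nsmul_eq_mul, mul_sum]
    refine sum_le_sum fun n hn => ?_
    rw [mem_Icc] at hn
    have := ff_avg d N n hd hn.1 hn.2 ell hl (T n) (hT n hn.1 hn.2) a ha ha1
    simpa using this

lemma sum_len_le {β : Type*} (A : Finset β) (a b : β → ℝ) (hab : ∀ x ∈ A, a x ≤ b x)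
    (hdis : ∀ x ∈ A, ∀ y ∈ A, x ≠ y → b x ≤ a y ∨ b y ≤ a x) (lo hi : ℝ) (hlh : lo ≤ hi)
    (hlo : ∀ x ∈ A, lo ≤ a x) (hhi : ∀ x ∈ A, b x ≤ hi) : ∑ x ∈ A, (b x - a x) ≤ hi - lo := by
  have h1 : MeasureTheory.volume (⋃ x ∈ A, Set.Ioo (a x) (b x)) = ∑ x ∈ A, MeasureTheory.volume (Set.Ioo (a x) (b x)) := by
    apply MeasureTheory.measure_biUnion_finset
    · intro x hx y hy hxy
      rw [Function.onFun, Set.disjoint_left]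
      rintro z ⟨h1, h2⟩ ⟨h3, h4⟩
      rcases hdis x hx y hy hxy with h | h <;> linarith
    · intros; exact measurableSet_Ioo
  have h2 : MeasureTheory.volume (⋃ x ∈ A, Set.Ioo (a x) (b x)) ≤ MeasureTheory.volume (Set.Icc lo hi) := by
    apply MeasureTheory.measure_mono
    refine Set.iUnion₂_subset fun x hx z hz => ?_
    have := hlo x hx; have := hhi x hx
    exact ⟨by linarith [hz.1], by linarith [hz.2]⟩
  rw [h1, Real.volume_Icc] at h2
  simp only [Real.volume_Ioo] at h2
  rw [← ENNReal.ofReal_sum_of_nonneg (fun x hx => sub_nonneg.2 (hab x hx))] at h2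
  exact (ENNReal.ofReal_le_ofReal_iff (sub_nonneg.2 hlh)).1 h2

lemma log_sum_small (T : ℕ → ℝ) (hT0 : ∀ n, 0 ≤ T n) (hT1 : ∀ n, T n ≤ 1) 
    (hT : Filter.Tendsto T Filter.atTop (nhds 0)) (a C e : ℝ) (ha : 0 < a) (hC : 0 < C) (he : 0 < e) :
    ∃ B : ℝ, ∀ N : ℕ, 0 < N → ∑ n ∈ Icc 1 N, C * T n ^ a / n ≤ e * Real.log N + B := by
  have h1 : Filter.Tendsto (fun n => C * T n ^ a) Filter.atTop (nhds 0) := by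
    have := (hT.rpow_const (p := a) (Or.inr ha.le)).const_mul C
    rwa [Real.zero_rpow ha.ne', mul_zero] at this
  obtain ⟨s0, hs0⟩ := Filter.eventually_atTop.1 (h1.eventually (gt_mem_nhds he))
  refine ⟨e + s0 * C, fun N hN => ?_⟩
  have hterm : ∀ n ∈ Icc 1 N, C * T n ^ a / n ≤ e * (n : ℝ)⁻¹ + if n < s0 then C else 0 := by
    intro n hn
    rw [mem_Icc] at hn
    have hn1 : (1 : ℝ) ≤ n := by exact_mod_cast hn.1
    have hTa : T n ^ a ≤ 1 := Real.rpow_le_one (hT0 n) (hT1 n) ha.le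
    have hTa0 : 0 ≤ T n ^ a := Real.rpow_nonneg (hT0 n) _
    split_ifs with h
    · have : C * T n ^ a / n ≤ C := by
        rw [div_le_iff₀ (by linarith)]
        nlinarith
      have : 0 ≤ e * (n : ℝ)⁻¹ := by positivity
      linarith
    · have := hs0 n (by omega)
      rw [div_eq_mul_inv, add_zero]
      gcongr
  refine (sum_le_sum hterm).trans ?_
  rw [sum_add_distrib, ← mul_sum]
  have h2 : ∑ n ∈ Icc 1 N, ((n : ℝ)⁻¹) ≤ 1 + Real.log N := by
    have := harmonic_le_one_add_log N
    rw [harmonic_eq_sum_Icc] at this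
    push_cast at this
    exact this
  have h3 : ∑ n ∈ Icc 1 N, (if n < s0 then C else 0) ≤ s0 * C := by
    rw [← sum_filter, sum_const, nsmul_eq_mul]
    apply mul_le_mul_of_nonneg_right _ hC.le
    have : #{n ∈ Icc 1 N | n < s0} ≤ #(range s0) := card_le_card fun x hx => by
      rw [mem_filter] at hx; exact mem_range.2 hx.2
    rw [card_range] at this
    exact_mod_cast this
  nlinarith


/-- The bundled hypotheses. -/
structure FFData (d : ℕ) (ρ : Matrix (Fin (d + 1)) (Fin (d + 1)) ℤ → ℝ → ℝ)
    (aJ bJ : (Fin d → ℤ) → ℝ) : Prop where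
  bij : ∀ M, IsUnitLowerTriangular M →
        Set.BijOn (ρ M) (Set.Icc (0 : ℝ) 1) (Set.Icc (0 : ℝ) 1)
  diff : ∀ M, IsUnitLowerTriangular M → ContDiffOn ℝ 1 (ρ M) (Set.Icc (0 : ℝ) 1)
  hol : ∀ M, IsUnitLowerTriangular M → ∃ C : ℝ,
        ∀ x ∈ Set.Icc (0 : ℝ) 1, ∀ y ∈ Set.Icc (0 : ℝ) 1,
          |derivWithin (ρ M) (Set.Icc (0 : ℝ) 1) x - derivWithin (ρ M) (Set.Icc (0 : ℝ) 1) y|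
            ≤ C * |x - y| ^ ((2 : ℝ) / ((d : ℝ) * ((d : ℝ) - 1)))
  act : ∀ M N, IsUnitLowerTriangular M → IsUnitLowerTriangular N →
        ∀ x ∈ Set.Icc (0 : ℝ) 1, ρ (M * N) x = ρ M (ρ N x)
  nondeg : ∀ v, aJ v < bJ v
  sub : ∀ v, Set.Icc (aJ v) (bJ v) ⊆ Set.Icc (0 : ℝ) 1
  lex : ∀ v w : Fin d → ℤ,
        (∃ k, (∀ m, m < k → v m = w m) ∧ v k < w k) → bJ v < aJ w
  img : ∀ M, IsUnitLowerTriangular M → ∀ v : Fin d → ℤ,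
        ρ M '' Set.Icc (aJ v) (bJ v) = Set.Icc (aJ (ndAct M v)) (bJ (ndAct M v))

lemma isUnitLowerTriangular_one {n : ℕ} : IsUnitLowerTriangular (1 : Matrix (Fin n) (Fin n) ℤ) :=
  ⟨fun i j h => Matrix.one_apply_ne h.ne, fun i => Matrix.one_apply_eq i⟩

lemma exists_left_inv {n : ℕ} (M : Matrix (Fin n) (Fin n) ℤ) (hM : IsUnitLowerTriangular M) :
    ∃ M', IsUnitLowerTriangular M' ∧ M' * M = 1 := by
  have hlow : M.BlockTriangular OrderDual.toDual := fun i j h => hM.1 i j h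
  have hdet : M.det = 1 := by
    rw [Matrix.det_of_isLowerTriangular M hlow]
    exact prod_eq_one fun i _ => hM.2 i
  have hu : IsUnit M.det := by rw [hdet]; exact isUnit_one
  let _ : Invertible M := Matrix.invertibleOfIsUnitDet M hu
  have hinv : (M⁻¹).BlockTriangular OrderDual.toDual := Matrix.blockTriangular_inv_of_blockTriangular hlow
  have h1 : M⁻¹ * M = 1 := Matrix.nonsing_inv_mul M hu
  refine ⟨M⁻¹, ⟨fun i j h => hinv h, fun i => ?_⟩, h1⟩
  have h2 := congrFun (congrFun h1 i) i
  rw [Matrix.mul_apply, Matrix.one_apply_eq, Finset.sum_eq_single i] at h2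
  · rwa [hM.2 i, mul_one] at h2
  · intro j _ hj
    rcases lt_or_gt_of_ne hj with h | h
    · rw [hM.1 j i h, mul_zero]
    · rw [hinv h, zero_mul]
  · simp

section
variable {d : ℕ} {ρ : Matrix (Fin (d + 1)) (Fin (d + 1)) ℤ → ℝ → ℝ} {aJ bJ : (Fin d → ℤ) → ℝ}

lemma FFData.one_id (F : FFData d ρ aJ bJ) (x : ℝ) (hx : x ∈ Set.Icc (0 : ℝ) 1) : ρ 1 x = x := by
  have h := F.act 1 1 isUnitLowerTriangular_one isUnitLowerTriangular_one x hx
  rw [mul_one] at h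
  have hb := F.bij 1 isUnitLowerTriangular_one
  exact (hb.injOn hx (hb.mapsTo hx) h).symm

lemma FFData.deriv_ne (F : FFData d ρ aJ bJ) (M) (hM : IsUnitLowerTriangular M) (x : ℝ)
    (hx : x ∈ Set.Icc (0 : ℝ) 1) : derivWithin (ρ M) (Set.Icc (0 : ℝ) 1) x ≠ 0 := by
  obtain ⟨M', hM', hMM⟩ := exists_left_inv M hM
  have hf := ((F.diff M hM).differentiableOn one_ne_zero x hx).hasDerivWithinAt
  have hfx := (F.bij M hM).mapsTo hx
  have hg := ((F.diff M' hM').differentiableOn one_ne_zero _ hfx).hasDerivWithinAt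
  have hc := hg.comp x hf (F.bij M hM).mapsTo
  have hid : HasDerivWithinAt (ρ M' ∘ ρ M) 1 (Set.Icc (0 : ℝ) 1) x := by
    apply (hasDerivWithinAt_id x _).congr
    · intro y hy
      rw [Function.comp, ← F.act M' M hM' hM y hy, hMM, F.one_id y hy]; rfl
    · rw [Function.comp, ← F.act M' M hM' hM x hx, hMM, F.one_id x hx]; rfl
  have hu := uniqueDiffOn_Icc (zero_lt_one (α := ℝ)) x hx
  have := hu.eq_deriv _ hc hid
  intro h0
  rw [h0, mul_zero] at this
  exact zero_ne_one this

lemma FFData.deriv_lower (F : FFData d ρ aJ bJ) (M) (hM : IsUnitLowerTriangular M) :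
    ∃ m : ℝ, 0 < m ∧ ∀ x ∈ Set.Icc (0 : ℝ) 1, m ≤ |derivWithin (ρ M) (Set.Icc (0 : ℝ) 1) x| := by
  have hc : ContinuousOn (fun x => |derivWithin (ρ M) (Set.Icc (0 : ℝ) 1) x|) (Set.Icc (0 : ℝ) 1) :=
    ((F.diff M hM).continuousOn_derivWithin (uniqueDiffOn_Icc zero_lt_one) le_rfl).abs
  obtain ⟨x, hx, hmin⟩ := isCompact_Icc.exists_isMinOn (Set.nonempty_Icc.2 zero_le_one) hc
  exact ⟨_, abs_pos.2 (F.deriv_ne M hM x hx), fun y hy => hmin hy⟩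

lemma FFData.mvt (F : FFData d ρ aJ bJ) (M) (hM : IsUnitLowerTriangular M) (v : Fin d → ℤ) :
    ∃ x ∈ Set.Icc (aJ v) (bJ v), bJ (ndAct M v) - aJ (ndAct M v) = 
      |derivWithin (ρ M) (Set.Icc (0 : ℝ) 1) x| * (bJ v - aJ v) := by
  have hab := F.nondeg v
  have hab' := F.nondeg (ndAct M v)
  have hsub := F.sub v
  have hcont : ContinuousOn (ρ M) (Set.Icc (aJ v) (bJ v)) := (F.diff M hM).continuousOn.mono hsub
  have h0 : 0 ≤ aJ v := (hsub (Set.left_mem_Icc.2 hab.le)).1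
  have h1 : bJ v ≤ 1 := (hsub (Set.right_mem_Icc.2 hab.le)).2
  have hnhds : ∀ x ∈ Set.Ioo (aJ v) (bJ v), Set.Icc (0 : ℝ) 1 ∈ nhds x := fun x hx =>
    Icc_mem_nhds (by linarith [hx.1]) (by linarith [hx.2])
  obtain ⟨c, hc, hslope⟩ := exists_deriv_eq_slope (ρ M) hab hcont (fun x hx => 
    (((F.diff M hM).differentiableOn one_ne_zero x 
      (hsub (Set.Ioo_subset_Icc_self hx))).differentiableAt (hnhds x hx)).differentiableWithinAt)
  refine ⟨c, Set.Ioo_subset_Icc_self hc, ?_⟩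
  rw [derivWithin_of_mem_nhds (hnhds c hc), hslope, abs_div, abs_of_pos (sub_pos.2 hab), 
    div_mul_cancel₀ _ (sub_pos.2 hab).ne']
  have himg := F.img M hM v
  have hinj : Set.InjOn (ρ M) (Set.Icc (aJ v) (bJ v)) := (F.bij M hM).injOn.mono hsub
  have hA : aJ v ∈ Set.Icc (aJ v) (bJ v) := Set.left_mem_Icc.2 hab.le
  have hB : bJ v ∈ Set.Icc (aJ v) (bJ v) := Set.right_mem_Icc.2 hab.le
  have ha1 : ρ M (aJ v) ∈ Set.Icc (aJ (ndAct M v)) (bJ (ndAct M v)) := himg ▸ Set.mem_image_of_mem _ hA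
  have hb1 : ρ M (bJ v) ∈ Set.Icc (aJ (ndAct M v)) (bJ (ndAct M v)) := himg ▸ Set.mem_image_of_mem _ hB
  obtain ⟨x, hx, hxe⟩ : aJ (ndAct M v) ∈ ρ M '' Set.Icc (aJ v) (bJ v) := 
    himg ▸ Set.left_mem_Icc.2 hab'.le
  obtain ⟨y, hy, hye⟩ : bJ (ndAct M v) ∈ ρ M '' Set.Icc (aJ v) (bJ v) := 
    himg ▸ Set.right_mem_Icc.2 hab'.le
  rcases hcont.strictMonoOn_of_injOn_Icc' hab.le hinj with hmono | hanti
  · have e1 := hmono.monotoneOn hA hx hx.1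
    have e2 := hmono.monotoneOn hy hB hy.2
    have e3 : ρ M (aJ v) = aJ (ndAct M v) := le_antisymm (by rw [← hxe]; exact e1) ha1.1
    have e4 : ρ M (bJ v) = bJ (ndAct M v) := le_antisymm hb1.2 (by rw [← hye]; exact e2)
    rw [e3, e4, abs_of_pos (sub_pos.2 hab')]
  · have e1 := hanti.antitoneOn hA hy hy.1
    have e2 := hanti.antitoneOn hx hB hx.2
    have e3 : ρ M (aJ v) = bJ (ndAct M v) := le_antisymm ha1.2 (by rw [← hye]; exact e1)
    have e4 : ρ M (bJ v) = aJ (ndAct M v) := le_antisymm (by rw [← hxe]; exact e2) hb1.1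
    rw [e3, e4, abs_sub_comm, abs_of_pos (sub_pos.2 hab')]

lemma abs_log_sub_le (a b m : ℝ) (hm : 0 < m) (ha : m ≤ a) (hb : m ≤ b) :
    |Real.log a - Real.log b| ≤ |a - b| / m := by
  have key : ∀ a b : ℝ, m ≤ a → m ≤ b → Real.log a - Real.log b ≤ |a - b| / m := by
    intro a b ha hb
    have ha0 : 0 < a := by linarith
    have hb0 : 0 < b := by linarith
    rw [← Real.log_div ha0.ne' hb0.ne']
    calc _ ≤ a / b - 1 := Real.log_le_sub_one_of_pos (by positivity)
      _ = (a - b) / b := by field_simp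
      _ ≤ |a - b| / b := by gcongr; exact le_abs_self _
      _ ≤ |a - b| / m := by gcongr
  rw [abs_le]
  have h1 := key a b ha hb
  have h2 := key b a hb ha
  rw [abs_sub_comm] at h2
  constructor <;> linarith

lemma ff_alpha_pos (hd : 2 ≤ d) : 0 < (2 : ℝ) / ((d : ℝ) * ((d : ℝ) - 1)) := by
  have : (2 : ℝ) ≤ d := by exact_mod_cast hd
  apply div_pos (by norm_num)
  apply mul_pos <;> linarith

lemma FFData.distort (F : FFData d ρ aJ bJ) (hd : 2 ≤ d) (M) (hM : IsUnitLowerTriangular M) :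
    ∃ C : ℝ, 0 ≤ C ∧ ∀ v v' : Fin d → ℤ, ∀ L : ℝ, 
      (∀ x ∈ Set.Icc (aJ v) (bJ v), ∀ y ∈ Set.Icc (aJ v') (bJ v'), |x - y| ≤ L) →
      |(Real.log (bJ (ndAct M v) - aJ (ndAct M v)) - Real.log (bJ v - aJ v)) - 
        (Real.log (bJ (ndAct M v') - aJ (ndAct M v')) - Real.log (bJ v' - aJ v'))| 
        ≤ C * L ^ ((2 : ℝ) / ((d : ℝ) * ((d : ℝ) - 1))) := by
  obtain ⟨m, hm, hlow⟩ := F.deriv_lower M hM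
  obtain ⟨C, hC⟩ := F.hol M hM
  refine ⟨|C| / m, by positivity, fun v v' L hL => ?_⟩
  obtain ⟨x, hx, hxe⟩ := F.mvt M hM v
  obtain ⟨y, hy, hye⟩ := F.mvt M hM v'
  have hx1 := F.sub v hx
  have hy1 := F.sub v' hy
  rw [hxe, hye, Real.log_mul (by have := hlow x hx1; linarith) (sub_pos.2 (F.nondeg v)).ne',
    Real.log_mul (by have := hlow y hy1; linarith) (sub_pos.2 (F.nondeg v')).ne',
    add_sub_cancel_right, add_sub_cancel_right]
  refine (abs_log_sub_le _ _ m hm (hlow x hx1) (hlow y hy1)).trans ?_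
  rw [div_mul_eq_mul_div]
  gcongr
  refine (abs_abs_sub_abs_le _ _).trans ((hC x hx1 y hy1).trans ?_)
  have hα := ff_alpha_pos hd
  have := hL x hx y hy
  gcongr
  exact le_abs_self C

lemma FFData.distort_unif (F : FFData d ρ aJ bJ) (hd : 2 ≤ d) :
    ∃ C : ℝ, 0 < C ∧ ∀ M, IsUnitLowerTriangular M → (∀ i j, M i j ∈ Set.Icc (0 : ℤ) 2) → 
      ∀ v v' : Fin d → ℤ, ∀ L : ℝ, 
      (∀ x ∈ Set.Icc (aJ v) (bJ v), ∀ y ∈ Set.Icc (aJ v') (bJ v'), |x - y| ≤ L) →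
      |(Real.log (bJ (ndAct M v) - aJ (ndAct M v)) - Real.log (bJ v - aJ v)) - 
        (Real.log (bJ (ndAct M v') - aJ (ndAct M v')) - Real.log (bJ v' - aJ v'))| 
        ≤ C * L ^ ((2 : ℝ) / ((d : ℝ) * ((d : ℝ) - 1))) := by
  have h := fun (M) (hM : IsUnitLowerTriangular M) => F.distort hd M hM
  choose! C hC0 hC using h
  have hfin : Set.Finite {M : Matrix (Fin (d + 1)) (Fin (d + 1)) ℤ | ∀ i j, M i j ∈ Set.Icc (0 : ℤ) 2} := by
    have h1 : Set.Finite {f : Fin (d + 1) → ℤ | ∀ j, f j ∈ Set.Icc (0 : ℤ) 2} :=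
      Set.Finite.pi' fun _ => Set.finite_Icc 0 2
    exact Set.Finite.pi' (t := fun _ => {f : Fin (d + 1) → ℤ | ∀ j, f j ∈ Set.Icc (0 : ℤ) 2}) fun _ => h1
  obtain ⟨B, hB⟩ := (hfin.image C).bddAbove
  refine ⟨max B 1, by positivity, fun M hM hMe v v' L hL => ?_⟩
  refine (hC M hM v v' L hL).trans ?_
  have hL0 : 0 ≤ L := (abs_nonneg _).trans (hL _ (Set.left_mem_Icc.2 (F.nondeg v).le) _ 
    (Set.left_mem_Icc.2 (F.nondeg v').le))
  apply mul_le_mul_of_nonneg_right _ (Real.rpow_nonneg hL0 _)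
  exact (hB ⟨M, hMe, rfl⟩).trans (le_max_left _ _)

end

/-- Unit lower triangular matrix with given entries below the diagonal. -/
def ffmat (d : ℕ) (e : ℕ → ℕ → ℤ) : Matrix (Fin (d + 1)) (Fin (d + 1)) ℤ :=
  fun i j => if i = j then 1 else if (j : ℕ) < i then e i j else 0

lemma ffmat_ult (d : ℕ) (e : ℕ → ℕ → ℤ) : IsUnitLowerTriangular (ffmat d e) := by
  refine ⟨fun i j h => ?_, fun i => by simp [ffmat]⟩
  have : ¬ (j : ℕ) < i := by have : (i : ℕ) < j := h; omega
  simp [ffmat, h.ne, this]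

lemma ndAct_ffmat (d : ℕ) (e : ℕ → ℕ → ℤ) (v : Fin d → ℤ) (U : ℕ → ℤ) (hU0 : U 0 = 1)
    (hU : ∀ j : Fin d, v j = U (j + 1)) (i : Fin d) :
    ndAct (ffmat d e) v i = U (i + 1) + ∑ j ∈ range (i + 1), e (i + 1) j * U j := by
  have hcons : (Fin.cons 1 v : Fin (d + 1) → ℤ) = fun j : Fin (d + 1) => U (j : ℕ) := by
    funext j
    refine Fin.cases ?_ (fun j => ?_) j
    · simp [hU0]
    · simp [hU]
  unfold ndAct
  rw [hcons, Matrix.mulVec, dotProduct]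
  have h1 : ∀ j : Fin (d + 1), ffmat d e i.succ j * U j = 
      (fun j : ℕ => (if j = (i : ℕ) + 1 then U j else 0) + if j < (i : ℕ) + 1 then e (i + 1) j * U j else 0) j := by
    intro j
    simp only [ffmat, Fin.ext_iff, Fin.val_succ]
    by_cases h : (i : ℕ) + 1 = j
    · rw [if_pos h, if_pos h.symm, if_neg (by omega)]; ring
    · rw [if_neg h, if_neg (Ne.symm h)]
      split_ifs <;> simp
  rw [sum_congr rfl fun j _ => h1 j, Fin.sum_univ_eq_sum_range 
    (fun j : ℕ => (if j = (i : ℕ) + 1 then U j else 0) + if j < (i : ℕ) + 1 then e (i + 1) j * U j else 0) (d + 1),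
    sum_add_distrib, sum_ite_eq' (range (d + 1)) ((i : ℕ) + 1) U, if_pos (by have := i.2; simp), ← sum_filter]
  congr 1
  apply sum_congr _ fun _ _ => rfl
  ext j
  have := i.2
  simp only [mem_filter, mem_range]
  omega

/-- The index in `ℤ^d` with first `d-1` entries given by the state `w` and last entry `k`. -/
def ffvec {d : ℕ} (w : Fin d → ℕ) (k : ℤ) : Fin d → ℤ :=
  fun i => if h : (i : ℕ) + 1 < d then (w ⟨i + 1, h⟩ : ℤ) else k

/-- Extension of the state to all natural indices. -/
def ffU {d : ℕ} (w : Fin d → ℕ) (k : ℤ) : ℕ → ℤ := fun j => if h : j < d then (w ⟨j, h⟩ : ℤ) else k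

lemma ffvec_eq_ffU {d : ℕ} (w : Fin d → ℕ) (k : ℤ) (j : Fin d) : ffvec w k j = ffU w k (j + 1) := rfl

/-- The path matrix. -/
def ffpm {d N : ℕ} (q : FFIdx d → Fin N) (s : ℕ) : Matrix (Fin (d + 1)) (Fin (d + 1)) ℤ :=
  ffmat d fun i j => if i < d then (ffcoef q i j s : ℤ) else 0

/-- The central matrix. -/
def ffhm (d : ℕ) : Matrix (Fin (d + 1)) (Fin (d + 1)) ℤ :=
  ffmat d fun i j => if i = d ∧ j = 0 then 1 else 0

lemma ffpm_bd {d N : ℕ} (hN : 0 < N) (q : FFIdx d → Fin N) (s : ℕ) (i j) : ffpm q s i j ∈ Set.Icc (0 : ℤ) 2 := by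
  unfold ffpm ffmat
  have := ffc_le N (ffext q i j) s (ffext_lt hN q i j)
  simp only [Set.mem_Icc, ffcoef]
  split_ifs <;> constructor <;> omega

lemma ffhm_bd {d : ℕ} (i j) : ffhm d i j ∈ Set.Icc (0 : ℤ) 2 := by
  unfold ffhm ffmat
  simp only [Set.mem_Icc]
  split_ifs <;> constructor <;> omega

lemma ffu_zero (c : ℕ → ℕ → ℕ → ℕ) (s : ℕ) : ffu c s 0 = 1 := by
  rw [ffu_eq_sum]; simp

lemma ffpm_act {d N : ℕ} (hd : 2 ≤ d) (q : FFIdx d → Fin N) (s : ℕ) (k : ℤ) :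
    ndAct (ffpm q s) (ffvec (ffstate q s) k) = ffvec (ffstate q (s + 1)) k := by
  funext i
  have hU0 : ffU (ffstate q s) k 0 = 1 := by
    have : 0 < d := by omega
    simp [ffU, this, ffstate, ffu_zero]
  rw [ffpm, ndAct_ffmat d _ _ (ffU (ffstate q s) k) hU0 (ffvec_eq_ffU _ _), ffvec_eq_ffU]
  by_cases h : (i : ℕ) + 1 < d
  · simp only [ffU, h, dif_pos, ffstate, if_true, ffu]
    push_cast
    congr 1
    refine sum_congr rfl fun j hj => ?_
    rw [mem_range] at hj
    rw [dif_pos (by omega)]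
  · simp [ffU, h]

lemma ffhm_act {d : ℕ} (hd : 2 ≤ d) (w : Fin d → ℕ) (hw : w ⟨0, by omega⟩ = 1) (k : ℤ) :
    ndAct (ffhm d) (ffvec w k) = ffvec w (k + 1) := by
  funext i
  have hU0 : ffU w k 0 = 1 := by
    have : 0 < d := by omega
    simp [ffU, this, hw]
  rw [ffhm, ndAct_ffmat d _ _ (ffU w k) hU0 (ffvec_eq_ffU _ _), ffvec_eq_ffU]
  by_cases h : (i : ℕ) + 1 < d
  · have h2 : (i : ℕ) + 1 ≠ d := by omega
    simp [ffU, h, h2]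
  · have h2 : (i : ℕ) + 1 = d := by have := i.2; omega
    have h3 : ∑ j ∈ range ((i : ℕ) + 1), (if (i : ℕ) + 1 = d ∧ j = 0 then (1 : ℤ) else 0) * ffU w k j = 1 := by
      rw [sum_eq_single 0]
      · simp [h2, hU0]
      · intro j _ hj; simp [hj]
      · simp
    rw [h3]
    simp [ffU, h]

lemma ffvec_lex {d : ℕ} (hd : 2 ≤ d) (w w' : Fin d → ℕ) (h0 : w ⟨0, by omega⟩ = w' ⟨0, by omega⟩) (hne : w ≠ w') :
    (∀ k k' : ℤ, ∃ i, (∀ m, m < i → ffvec w k m = ffvec w' k' m) ∧ ffvec w k i < ffvec w' k' i) ∨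
    (∀ k k' : ℤ, ∃ i, (∀ m, m < i → ffvec w' k m = ffvec w k' m) ∧ ffvec w' k i < ffvec w k' i) := by
  classical
  have hex : ∃ n, ∃ h : n < d, w ⟨n, h⟩ ≠ w' ⟨n, h⟩ := by
    by_contra hcon
    push Not at hcon
    exact hne (funext fun i => hcon i i.2)
  obtain ⟨n, ⟨hlt, hdiff⟩, hmin'⟩ : ∃ n, (∃ h : n < d, w ⟨n, h⟩ ≠ w' ⟨n, h⟩) ∧
      ∀ m, m < n → ¬ ∃ h : m < d, w ⟨m, h⟩ ≠ w' ⟨m, h⟩ :=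
    ⟨Nat.find hex, Nat.find_spec hex, fun m => Nat.find_min hex⟩
  have hmin : ∀ m, m < n → ∀ h : m < d, w ⟨m, h⟩ = w' ⟨m, h⟩ := by
    intro m hm h
    have := hmin' m hm
    push Not at this
    exact this h
  obtain ⟨p, rfl⟩ : ∃ p, n = p + 1 := by
    apply Nat.exists_eq_succ_of_ne_zero
    intro h
    subst h
    exact hdiff h0
  have hpd : p + 1 < d := by omega
  have hag : ∀ k k' : ℤ, ∀ m : Fin d, m < ⟨p, by omega⟩ → ffvec w k m = ffvec w' k' m := by
    intro k k' m hm
    have hm' : (m : ℕ) < p := hm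
    have h2 : (m : ℕ) + 1 < d := by omega
    simp only [ffvec, h2, dif_pos]
    rw [hmin _ (by omega)]
  have hd2 : w ⟨p + 1, hpd⟩ ≠ w' ⟨p + 1, hpd⟩ := hdiff
  rcases lt_or_gt_of_ne hd2 with h | h
  · left
    intro k k'
    refine ⟨⟨p, by omega⟩, hag k k', ?_⟩
    simp only [ffvec, hpd, dif_pos]
    exact_mod_cast h
  · right
    intro k k'
    refine ⟨⟨p, by omega⟩, fun m hm => (hag k' k m hm).symm, ?_⟩
    simp only [ffvec, hpd, dif_pos]
    exact_mod_cast h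

section
variable {d : ℕ} {ρ : Matrix (Fin (d + 1)) (Fin (d + 1)) ℤ → ℝ → ℝ} {aJ bJ : (Fin d → ℤ) → ℝ}

lemma FFData.a_nonneg (F : FFData d ρ aJ bJ) (v) : 0 ≤ aJ v := 
  (F.sub v (Set.left_mem_Icc.2 (F.nondeg v).le)).1

lemma FFData.b_le (F : FFData d ρ aJ bJ) (v) : bJ v ≤ 1 := 
  (F.sub v (Set.right_mem_Icc.2 (F.nondeg v).le)).2

/-- Left endpoint of the hull. -/
noncomputable def ffaI (aJ : (Fin d → ℤ) → ℝ) (w : Fin d → ℕ) : ℝ := ⨅ k : ℤ, aJ (ffvec w k)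
/-- Right endpoint of the hull. -/
noncomputable def ffbI (bJ : (Fin d → ℤ) → ℝ) (w : Fin d → ℕ) : ℝ := ⨆ k : ℤ, bJ (ffvec w k)

lemma FFData.aI_le (F : FFData d ρ aJ bJ) (w : Fin d → ℕ) (k : ℤ) : ffaI aJ w ≤ aJ (ffvec w k) :=
  ciInf_le ⟨0, by rintro _ ⟨k, rfl⟩; exact F.a_nonneg _⟩ k

lemma FFData.le_bI (F : FFData d ρ aJ bJ) (w : Fin d → ℕ) (k : ℤ) : bJ (ffvec w k) ≤ ffbI bJ w :=
  le_ciSup (f := fun k : ℤ => bJ (ffvec w k)) ⟨1, by rintro _ ⟨k, rfl⟩; exact F.b_le _⟩ k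

lemma FFData.aI_le_bI (F : FFData d ρ aJ bJ) (w : Fin d → ℕ) : ffaI aJ w ≤ ffbI bJ w :=
  (F.aI_le w 0).trans ((F.nondeg _).le.trans (F.le_bI w 0))

lemma FFData.ell_le_one (F : FFData d ρ aJ bJ) (w : Fin d → ℕ) : ffbI bJ w - ffaI aJ w ≤ 1 := by
  have h1 : ffbI bJ w ≤ 1 := ciSup_le fun k => F.b_le _
  have h2 : 0 ≤ ffaI aJ w := le_ciInf fun k => F.a_nonneg _
  linarith

lemma FFData.hull (F : FFData d ρ aJ bJ) (w : Fin d → ℕ) (k k' : ℤ) :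
    ∀ x ∈ Set.Icc (aJ (ffvec w k)) (bJ (ffvec w k)), ∀ y ∈ Set.Icc (aJ (ffvec w k')) (bJ (ffvec w k')), 
      |x - y| ≤ ffbI bJ w - ffaI aJ w := by
  intro x hx y hy
  have h1 := F.aI_le w k
  have h2 := F.aI_le w k'
  have h3 := F.le_bI w k
  have h4 := F.le_bI w k'
  rw [abs_le]
  constructor <;> linarith [hx.1, hx.2, hy.1, hy.2]

lemma FFData.hull_disj (F : FFData d ρ aJ bJ) (hd : 2 ≤ d) (w w' : Fin d → ℕ) 
    (h0 : w ⟨0, by omega⟩ = w' ⟨0, by omega⟩) (hne : w ≠ w') : 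
    ffbI bJ w ≤ ffaI aJ w' ∨ ffbI bJ w' ≤ ffaI aJ w := by
  rcases ffvec_lex hd w w' h0 hne with h | h
  · left
    exact ciSup_le fun k => le_ciInf fun k' => (F.lex _ _ (h k k')).le
  · right
    exact ciSup_le fun k => le_ciInf fun k' => (F.lex _ _ (h k k')).le

/-- marker index -/
def ffmk (d : ℕ) (n : ℤ) : Fin d → ℤ := fun i => if (i : ℕ) = 0 then n else 0

lemma ff_lex_first (hd : 2 ≤ d) (v v' : Fin d → ℤ) (h : v ⟨0, by omega⟩ < v' ⟨0, by omega⟩) :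
    ∃ k, (∀ m, m < k → v m = v' m) ∧ v k < v' k :=
  ⟨⟨0, by omega⟩, fun m hm => absurd hm (by simp [Fin.lt_def]), h⟩

lemma ffvec_last (hd : 2 ≤ d) (w : Fin d → ℕ) {k k' : ℤ} (h : k < k') :
    ∃ i, (∀ m, m < i → ffvec w k m = ffvec w k' m) ∧ ffvec w k i < ffvec w k' i := by
  refine ⟨⟨d - 1, by omega⟩, fun m hm => ?_, ?_⟩
  · have hm' : (m : ℕ) < d - 1 := hm
    have : (m : ℕ) + 1 < d := by omega
    simp [ffvec, this]
  · have : ¬ (d - 1 + 1 < d) := by omega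
    simp [ffvec, this, h]

/-- Sum of lengths in one fibre. -/
lemma FFData.sum_fibre (F : FFData d ρ aJ bJ) (hd : 2 ≤ d) (w : Fin d → ℕ) (g : ℕ → ℤ) 
    (hg : Function.Injective g) (N : ℕ) :
    ∑ k ∈ range N, (bJ (ffvec w (g k)) - aJ (ffvec w (g k))) ≤ 1 := by
  have := sum_len_le (range N) (fun k => aJ (ffvec w (g k))) (fun k => bJ (ffvec w (g k))) 
    (fun k _ => (F.nondeg _).le) (fun x _ y _ hxy => ?_) 0 1 zero_le_one 
    (fun k _ => F.a_nonneg _) (fun k _ => F.b_le _)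
  · simpa using this
  · rcases lt_or_gt_of_ne (fun h => hxy (hg h)) with h | h
    · left; exact (F.lex _ _ (ffvec_last hd w h)).le
    · right; exact (F.lex _ _ (ffvec_last hd w h)).le

lemma FFData.exists_nondecr (F : FFData d ρ aJ bJ) (hd : 2 ≤ d) (w : Fin d → ℕ) :
    ∃ k : ℤ, bJ (ffvec w k) - aJ (ffvec w k) ≤ bJ (ffvec w (k + 1)) - aJ (ffvec w (k + 1)) := by
  by_contra hcon
  push Not at hcon
  set l : ℤ → ℝ := fun k => bJ (ffvec w k) - aJ (ffvec w k) with hl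
  have h1 : ∀ k : ℕ, l 0 ≤ l (-(k : ℤ)) := by
    intro k
    induction k with
    | zero => simp
    | succ k ih =>
      refine ih.trans ?_
      have := hcon (-((k + 1 : ℕ) : ℤ))
      have e : -((k + 1 : ℕ) : ℤ) + 1 = -(k : ℤ) := by push_cast; ring
      rw [e] at this
      exact this.le
  have hpos : 0 < l 0 := sub_pos.2 (F.nondeg _)
  obtain ⟨N, hN⟩ := exists_nat_gt (1 / l 0)
  have h2 := F.sum_fibre hd w (fun k => -(k : ℤ)) (fun a b h => by simpa using h) N
  have h3 : ∑ k ∈ range N, l 0 ≤ ∑ k ∈ range N, l (-(k : ℤ)) := sum_le_sum fun k _ => h1 k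
  rw [sum_const, card_range, nsmul_eq_mul] at h3
  rw [div_lt_iff₀ hpos] at hN
  have : ∑ k ∈ range N, l (-(k : ℤ)) ≤ 1 := h2
  linarith

lemma ffstate_zero_coord (hd : 2 ≤ d) {N : ℕ} (q : FFIdx d → Fin N) (n : ℕ) : ffstate q n ⟨0, by omega⟩ = 1 :=
  ffu_zero _ _

/-- tail bound -/
lemma FFData.tail (F : FFData d ρ aJ bJ) (hd : 2 ≤ d) (N n : ℕ) :
    ∑ w ∈ univ.image (fun q : FFIdx d → Fin N => ffstate q n), (ffbI bJ w - ffaI aJ w) ≤ 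
      (⨆ m : ℕ, bJ (ffmk d m)) - bJ (ffmk d n) := by
  have hbd : BddAbove (Set.range fun m : ℕ => bJ (ffmk d m)) := ⟨1, by rintro _ ⟨k, rfl⟩; exact F.b_le _⟩
  have h1d : 0 + 1 < d := by omega
  apply sum_len_le
  · intro w _; exact F.aI_le_bI w
  · intro w hw w' hw' hne
    simp only [mem_image, mem_univ, true_and] at hw hw'
    obtain ⟨q, rfl⟩ := hw
    obtain ⟨q', rfl⟩ := hw'
    exact F.hull_disj hd _ _ ((ffstate_zero_coord hd q n).trans (ffstate_zero_coord hd q' n).symm) hne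
  · exact le_ciSup hbd n
  · intro w hw
    simp only [mem_image, mem_univ, true_and] at hw
    obtain ⟨q, rfl⟩ := hw
    refine le_ciInf fun k => (F.lex _ _ (ff_lex_first hd _ _ ?_)).le
    have h1 := ffu_lower (ffcoef q) (fun i j s => ffc_pos _ _ _) n 1
    simp only [Nat.choose_one_right] at h1
    simp only [ffmk, ffvec, h1d, dif_pos, ffstate, if_true, zero_add]
    exact_mod_cast h1
  · intro w _
    refine ciSup_le fun k => ?_
    refine le_trans ((F.lex _ (ffmk d ((w ⟨1, h1d⟩ + 1 : ℕ) : ℤ)) (ff_lex_first hd _ _ ?_)).le.trans (F.nondeg _).le) 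
      (le_ciSup hbd (w ⟨1, h1d⟩ + 1))
    simp [ffmk, ffvec, h1d]

end

lemma ff_final (d : ℕ) (hd : 2 ≤ d) (ρ : Matrix (Fin (d + 1)) (Fin (d + 1)) ℤ → ℝ → ℝ)
    (aJ bJ : (Fin d → ℤ) → ℝ) (F : FFData d ρ aJ bJ) : False := by
  obtain ⟨C, hC, hdist⟩ := F.distort_unif hd
  set a := (2 : ℝ) / ((d : ℝ) * ((d : ℝ) - 1)) with ha
  have ha0 : 0 < a := ff_alpha_pos hd
  have hd2 : (2 : ℝ) ≤ d := by exact_mod_cast hd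
  have ha1 : a ≤ 1 := by
    rw [ha, div_le_one (by nlinarith)]; nlinarith
  have hcard : a * Fintype.card (FFIdx d) = 1 := by
    rw [card_FFIdx]
    have h := Finset.sum_range_id_mul_two d
    have h2 : ((∑ i ∈ range d, i : ℕ) : ℝ) * 2 = d * ((d : ℝ) - 1) := by
      have := congrArg (Nat.cast (R := ℝ)) h
      rw [Nat.cast_mul, Nat.cast_mul, Nat.cast_sub (by omega)] at this
      simpa using this
    have h3 : (d : ℝ) * ((d : ℝ) - 1) ≠ 0 := by nlinarith
    rw [ha, div_mul_eq_mul_div, div_eq_one_iff_eq h3]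
    linarith
  set ell : (Fin d → ℕ) → ℝ := fun w => ffbI bJ w - ffaI aJ w with hell
  have hell0 : ∀ w, 0 ≤ ell w := fun w => sub_nonneg.2 (F.aI_le_bI w)
  set T : ℕ → ℝ := fun n => (⨆ m : ℕ, bJ (ffmk d m)) - bJ (ffmk d n) with hT
  have hbd : BddAbove (Set.range fun m : ℕ => bJ (ffmk d m)) := ⟨1, by rintro _ ⟨k, rfl⟩; exact F.b_le _⟩
  have hmono : Monotone fun m : ℕ => bJ (ffmk d m) := by
    apply monotone_nat_of_le_succ
    intro m
    refine (F.lex _ _ (ff_lex_first hd _ _ ?_)).le.trans (F.nondeg _).le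
    simp [ffmk]
  have hTlim : Filter.Tendsto T Filter.atTop (nhds 0) := by
    have := (tendsto_atTop_ciSup hmono hbd).const_sub (⨆ m : ℕ, bJ (ffmk d m))
    rwa [sub_self] at this
  have hT0 : ∀ n, 0 ≤ T n := fun n => sub_nonneg.2 (le_ciSup hbd n)
  have hT1 : ∀ n, T n ≤ 1 := fun n => by
    have h1 : (⨆ m : ℕ, bJ (ffmk d m)) ≤ 1 := ciSup_le fun m => F.b_le _
    have h2 : 0 ≤ bJ (ffmk d n) := (F.a_nonneg _).trans (F.nondeg _).le
    simp only [hT]; linarith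
  obtain ⟨B, hB⟩ := log_sum_small T hT0 hT1 hTlim a ((3 * 6 ^ d * d.factorial + 1 : ℕ) : ℝ) (1 / (4 * C))
    ha0 (by positivity) (by positivity)
  set len : (Fin d → ℤ) → ℝ := fun v => bJ v - aJ v with hlen
  have hlenpos : ∀ v, 0 < len v := fun v => sub_pos.2 (F.nondeg v)
  set o : Fin d → ℕ := fun _ => 1 with ho
  -- main lower bound
  have main : ∀ N : ℕ, 0 < N → ∀ k : ℕ, k < N → 
      Real.log (len (ffvec o 0)) - C * (1 + 2 * (1 / (4 * C) * Real.log N + B)) ≤ Real.log (len (ffvec o k)) := by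
    intro N hN k hk
    set R := 1 / (4 * C) * Real.log N + B with hR
    obtain ⟨q, hq⟩ := ff_exists_path d N hd hN ell hell0 T (fun n _ _ => F.tail hd N n) a hcard ha1
    have hqR := hq.trans (hB N hN)
    have hea : ∀ n, 0 ≤ ell (ffstate q n) ^ a := fun n => Real.rpow_nonneg (hell0 _) _
    have hNr : (0 : ℝ) < N := by exact_mod_cast hN
    obtain ⟨n, hn, hnR⟩ : ∃ n ∈ Icc 1 N, ell (ffstate q n) ^ a ≤ R / N := by
      apply Finset.exists_le_of_sum_le (f := fun n => ell (ffstate q n) ^ a) (g := fun _ => R / N)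
      · exact ⟨1, by simp; omega⟩
      · rw [sum_const, Nat.card_Icc, nsmul_eq_mul]
        simp only [add_tsub_cancel_right]
        rw [mul_div_cancel₀ _ hNr.ne']
        exact hqR
    rw [mem_Icc] at hn
    have hR0 : 0 ≤ R := (sum_nonneg fun n _ => hea n).trans hqR
    -- distortion along the path
    have hpath : ∀ n, |(Real.log (len (ffvec (ffstate q n) k)) - Real.log (len (ffvec (ffstate q n) 0))) -
        (Real.log (len (ffvec o k)) - Real.log (len (ffvec o 0)))| ≤ C * ∑ s ∈ range n, ell (ffstate q s) ^ a := by
      intro n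
      induction n with
      | zero =>
        have : ffstate q 0 = o := by funext i; simp [ffstate, ffu, ho]
        simp [this]
      | succ n ih =>
        have h := hdist (ffpm q n) (ffmat_ult _ _) (ffpm_bd hN q n) (ffvec (ffstate q n) k) (ffvec (ffstate q n) 0)
          (ell (ffstate q n)) (F.hull _ _ _)
        rw [ffpm_act hd, ffpm_act hd] at h
        change |(Real.log (len (ffvec (ffstate q (n + 1)) k)) - Real.log (len (ffvec (ffstate q n) k))) -
          (Real.log (len (ffvec (ffstate q (n + 1)) 0)) - Real.log (len (ffvec (ffstate q n) 0)))| ≤ _ at h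
        rw [sum_range_succ, mul_add]
        rw [abs_le] at *
        constructor <;> linarith
    have hsum : ∑ s ∈ range n, ell (ffstate q s) ^ a ≤ 1 + R := by
      calc _ ≤ ∑ s ∈ insert 0 (Icc 1 N), ell (ffstate q s) ^ a := by
            apply sum_le_sum_of_subset_of_nonneg
            · intro s hs
              rw [mem_range] at hs
              simp only [mem_insert, mem_Icc]; omega
            · intro s _ _; exact hea s
        _ = ell (ffstate q 0) ^ a + ∑ s ∈ Icc 1 N, ell (ffstate q s) ^ a := sum_insert (by simp)
        _ ≤ _ := add_le_add (Real.rpow_le_one (hell0 _) (F.ell_le_one _) ha0.le) hqR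
    -- the central element at the end of the path
    set w := ffstate q n with hw
    have hw0 : w ⟨0, by omega⟩ = 1 := ffstate_zero_coord hd q n
    obtain ⟨k0, hk0⟩ := F.exists_nondecr hd w
    have hstep : ∀ j : ℤ, Real.log (len (ffvec w j)) - C * ell w ^ a ≤ Real.log (len (ffvec w (j + 1))) := by
      intro j
      have h := hdist (ffhm d) (ffmat_ult _ _) ffhm_bd (ffvec w j) (ffvec w k0) (ell w) (F.hull _ _ _)
      rw [ffhm_act hd w hw0, ffhm_act hd w hw0] at h
      change |(Real.log (len (ffvec w (j + 1))) - Real.log (len (ffvec w j))) -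
          (Real.log (len (ffvec w (k0 + 1))) - Real.log (len (ffvec w k0)))| ≤ _ at h
      have h2 : Real.log (len (ffvec w k0)) ≤ Real.log (len (ffvec w (k0 + 1))) :=
        Real.log_le_log (hlenpos _) hk0
      rw [abs_le] at h
      linarith [h.1]
    have hiter : ∀ j : ℕ, Real.log (len (ffvec w 0)) - j * (C * ell w ^ a) ≤ Real.log (len (ffvec w j)) := by
      intro j
      induction j with
      | zero => simp
      | succ j ih =>
        have := hstep j
        push_cast
        linarith
    have hend : (k : ℝ) * (C * ell w ^ a) ≤ C * R := by
      have hkN : (k : ℝ) ≤ N := by exact_mod_cast hk.le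
      calc (k : ℝ) * (C * ell w ^ a) ≤ N * (C * (R / N)) := by
            gcongr
            exact mul_nonneg hC.le (hea n)
        _ = C * R := by field_simp
    have h1 := hiter k
    have h2 := hpath n
    rw [abs_le] at h2
    have h3 : C * ∑ s ∈ range n, ell (ffstate q s) ^ a ≤ C * (1 + R) := by gcongr
    nlinarith [h2.2]
  set c := len (ffvec o 0) * Real.exp (-(C * (1 + 2 * B))) with hc
  have hcpos : 0 < c := mul_pos (hlenpos _) (Real.exp_pos _)
  have main2 : ∀ N : ℕ, 0 < N → ∀ k : ℕ, k < N → c * (N : ℝ) ^ (-(1 / 2 : ℝ)) ≤ len (ffvec o k) := by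
    intro N hN k hk
    have h := main N hN k hk
    have hNr : (0 : ℝ) < N := by exact_mod_cast hN
    rw [← Real.log_le_log_iff (by positivity) (hlenpos _), Real.log_mul hcpos.ne' (by positivity), 
      Real.log_rpow hNr, hc, Real.log_mul (hlenpos _).ne' (Real.exp_pos _).ne', Real.log_exp]
    refine le_trans (le_of_eq ?_) h
    field_simp
    ring
  obtain ⟨N, hN⟩ := exists_nat_gt ((1 / c) ^ 2)
  have hNr : (0 : ℝ) < N := lt_of_le_of_lt (by positivity) hN
  have hN0 : 0 < N := by exact_mod_cast hNr
  have hs := F.sum_fibre hd o (fun k => (k : ℤ)) (fun a b h => by simpa using h) N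
  have h1 : ∑ k ∈ range N, c * (N : ℝ) ^ (-(1 / 2 : ℝ)) ≤ ∑ k ∈ range N, len (ffvec o k) :=
    sum_le_sum fun k hk => main2 N hN0 k (mem_range.1 hk)
  rw [sum_const, card_range, nsmul_eq_mul] at h1
  have h2 : (N : ℝ) * (c * (N : ℝ) ^ (-(1 / 2 : ℝ))) = c * Real.sqrt N := by
    rw [Real.rpow_neg hNr.le, ← Real.sqrt_eq_rpow]
    have hsq : Real.sqrt N * Real.sqrt N = N := Real.mul_self_sqrt hNr.le
    have : 0 < Real.sqrt N := Real.sqrt_pos.2 hNr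
    field_simp
    nlinarith
  have h3 : 1 / c < Real.sqrt N := Real.lt_sqrt_of_sq_lt hN
  rw [div_lt_iff₀ hcpos] at h3
  have h4 : ∑ k ∈ range N, len (ffvec o k) ≤ 1 := hs
  linarith

end

/-- **Non-smoothability of the Farb–Franks action in critical regularity (Theorem C).**
For `d ≥ 2` and `α = 2/(d(d-1))`, there is no action `ρ` of `N_d` on `[0,1]` by
`C^{1+α}` diffeomorphisms together with a family `{J_v = [aJ v, bJ v] : v ∈ ℤ^d}` of
pairwise disjoint nondegenerate subintervals of `[0,1]`, disposed respecting the
lexicographic order, such that `ρ(f)(J_v) = J_{f·v}` for all `f ∈ N_d`, `v ∈ ℤ^d`. -/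
theorem farb_franks_not_smoothable_critical (d : ℕ) (hd : 2 ≤ d) :
    ¬ ∃ (ρ : Matrix (Fin (d + 1)) (Fin (d + 1)) ℤ → ℝ → ℝ)
        (aJ bJ : (Fin d → ℤ) → ℝ),
      (∀ M, IsUnitLowerTriangular M →
        Set.BijOn (ρ M) (Set.Icc (0 : ℝ) 1) (Set.Icc (0 : ℝ) 1)) ∧
      (∀ M, IsUnitLowerTriangular M → ContDiffOn ℝ 1 (ρ M) (Set.Icc (0 : ℝ) 1)) ∧
      (∀ M, IsUnitLowerTriangular M → ∃ C : ℝ,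
        ∀ x ∈ Set.Icc (0 : ℝ) 1, ∀ y ∈ Set.Icc (0 : ℝ) 1,
          |derivWithin (ρ M) (Set.Icc (0 : ℝ) 1) x - derivWithin (ρ M) (Set.Icc (0 : ℝ) 1) y|
            ≤ C * |x - y| ^ ((2 : ℝ) / ((d : ℝ) * ((d : ℝ) - 1)))) ∧
      (∀ M N, IsUnitLowerTriangular M → IsUnitLowerTriangular N →
        ∀ x ∈ Set.Icc (0 : ℝ) 1, ρ (M * N) x = ρ M (ρ N x)) ∧
      (∀ v, aJ v < bJ v) ∧
      (∀ v, Set.Icc (aJ v) (bJ v) ⊆ Set.Icc (0 : ℝ) 1) ∧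
      (∀ v w : Fin d → ℤ,
        (∃ k, (∀ m, m < k → v m = w m) ∧ v k < w k) → bJ v < aJ w) ∧
      (∀ M, IsUnitLowerTriangular M → ∀ v : Fin d → ℤ,
        ρ M '' Set.Icc (aJ v) (bJ v) = Set.Icc (aJ (ndAct M v)) (bJ (ndAct M v))) := by
  rintro ⟨ρ, aJ, bJ, h1, h2, h3, h4, h5, h6, h7, h8⟩
  exact ff_final d hd ρ aJ bJ ⟨h1, h2, h3, h4, h5, h6, h7, h8⟩
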